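/- arXiv:math/0206297 — 2 statements merged into one kernel-verified Lean document; each statement's English description precedes it below -/
import Mathlib

section
/- Let k be an algebraically closed field of characteristic zero, A a finitely generated commutative k-algebra, G a finite group acting on A by k-algebra automorphisms, and E a bounded-above cochain complex of finitely generated projective A-modules, each term carrying a G-equivariant structure and all differentials G-equivariant. Then there exist a bounded-above cochain complex Q of projective A^G-modules and a G-equivariant quasi-isomorphism A ⊗_{A^G} Q → E if and only if for every maximal ideal n of A and every integer j the stabilizer G_n acts trivially (fixes every element) on H^j(E ⊗_A A/n). -/
/-!
STATEMENT 4 (descent of equivariant complexes over an algebraically closed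
field, conditions (1) ⟺ (3)): let `k` be an algebraically closed field of
characteristic zero, `A` a finitely generated commutative `k`-algebra, `G` a
finite group acting on `A` by `k`-algebra automorphisms, and `E` a
bounded-above `G`-equivariant cochain complex of finitely generated
projective `A`-modules.  Then there are a bounded-above cochain complex `Q`
of projective `Aᴳ`-modules and a `G`-equivariant quasi-isomorphism
`A ⊗[Aᴳ] Q → E` if and only if for every maximal ideal `n` of `A` and every
`j` the stabilizer `G_n` acts trivially on `H^j(E ⊗[A] A/n)`.

Conventions:
* `H^j(E ⊗[A] A/n)` is computed from the termwise fibers `E^j/nE^j` (the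
  terms are flat, so this computes `E ⊗^L A/n`); triviality of the
  `G_n`-action is expressed elementwise: for every mod-`n` cocycle `x` and
  every `g ∈ G_n`, `g • x - x ∈ range(d^{j-1}) ⊔ n • ⊤`.
* In (1), the base-changed complex has terms `A ⊗[Aᴳ] Q^j` and differentials
  `baseChange` of those of `Q`; quasi-isomorphism is expressed elementwise.
-/

open TensorProduct

universe u v w

/-- A (`ℤ`-indexed, cohomologically graded) cochain complex of `R`-modules,
with differentials indexed by pairs `(i, j)` with `i + 1 = j`. -/
structure ModComplex.{s, r} (R : Type s) [Ring R] : Type (max s (r + 1)) where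
  X : ℤ → Type r
  [acg : ∀ j, AddCommGroup (X j)]
  [mod : ∀ j, Module R (X j)]
  d : ∀ i j : ℤ, i + 1 = j → (X i →ₗ[R] X j)
  d_comp_d : ∀ (i j l : ℤ) (hij : i + 1 = j) (hjl : j + 1 = l) (x : X i),
    d j l hjl (d i j hij x) = 0

attribute [instance] ModComplex.acg ModComplex.mod

/-- A `G`-equivariant cochain complex of `A`-modules: each term carries a
`G`-action compatible with the `G`-action on `A`, and the differentials are
`G`-equivariant. -/
structure EqvModComplex.{s, t, r} (A : Type s) (G : Type t) [CommRing A]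
    [Group G] [MulSemiringAction G A] : Type (max s t (r + 1)) where
  X : ℤ → Type r
  [acg : ∀ j, AddCommGroup (X j)]
  [mod : ∀ j, Module A (X j)]
  [act : ∀ j, DistribMulAction G (X j)]
  equivariant : ∀ (j : ℤ) (g : G) (a : A) (x : X j),
    g • (a • x) = (g • a) • (g • x)
  d : ∀ i j : ℤ, i + 1 = j → (X i →ₗ[A] X j)
  d_comp_d : ∀ (i j l : ℤ) (hij : i + 1 = j) (hjl : j + 1 = l) (x : X i),
    d j l hjl (d i j hij x) = 0
  d_equivariant : ∀ (i j : ℤ) (h : i + 1 = j) (g : G) (x : X i),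
    d i j h (g • x) = g • d i j h x

attribute [instance] EqvModComplex.acg EqvModComplex.mod EqvModComplex.act


/-- The invariant subalgebra `Aᴳ` of the `G`-action on the `k`-algebra `A`. -/
def invAlg (k : Type*) (A : Type u) (G : Type*) [CommSemiring k] [CommRing A]
    [Algebra k A] [Group G] [MulSemiringAction G A] [SMulCommClass G k A] :
    Subalgebra k A where
  carrier := {a | ∀ g : G, g • a = a}
  mul_mem' := fun ha hb g => by rw [smul_mul', ha g, hb g]
  add_mem' := fun ha hb g => by rw [smul_add, ha g, hb g]
  algebraMap_mem' := fun c g => by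
    rw [Algebra.algebraMap_eq_smul_one, smul_comm, smul_one]

section Helpers

set_option linter.all false
set_option linter.unusedSectionVars false
set_option linter.style.haveILetI false

/-- A bounded-above complex of projectives that is exact above `j0` has partial sections. -/
theorem exists_section_aux {A : Type*} [CommRing A] (X : ℤ → Type*) [∀ j, AddCommGroup (X j)]
    [∀ j, Module A (X j)] [∀ j, Module.Projective A (X j)]
    (d : ∀ i : ℤ, X i →ₗ[A] X (i + 1)) (hdd : ∀ i x, d (i + 1) (d i x) = 0)
    (b : ℤ) (hb : ∀ j, b < j → ∀ x : X j, x = 0) (j0 : ℤ)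
    (hex : ∀ i, j0 < i + 1 → ∀ x : X (i + 1), d (i + 1) x = 0 → ∃ y, d i y = x) :
    ∀ (n : ℕ) (i : ℤ), j0 < i + 1 → b < i + 1 + n →
      ∃ s : X (i + 1) →ₗ[A] X i, ∀ z, d (i + 1) z = 0 → d i (s z) = z := by
  intro n
  induction n with
  | zero =>
    intro i _ hbi
    refine ⟨0, fun z _ => ?_⟩
    rw [hb (i + 1) (by simpa using hbi) z]; simp
  | succ n ih =>
    intro i hi hbi
    obtain ⟨s, hs⟩ := ih (i + 1) (by omega) (by push_cast at hbi; omega)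
    let f : X i →ₗ[A] LinearMap.ker (d (i + 1)) :=
      (d i).codRestrict _ (fun x => by simp [hdd])
    let g : X (i + 1) →ₗ[A] LinearMap.ker (d (i + 1)) :=
      (LinearMap.id - s ∘ₗ d (i + 1)).codRestrict _ (fun x => by
        simp [hs _ (hdd (i + 1) x)])
    obtain ⟨h, hh⟩ := Module.projective_lifting_property f g (by
      rintro ⟨x, hx⟩
      obtain ⟨y, hy⟩ := hex i hi x hx
      exact ⟨y, Subtype.ext hy⟩)
    refine ⟨h, fun z hz => ?_⟩
    have := congrArg Subtype.val (LinearMap.congr_fun hh z)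
    simpa [f, g, hz] using this

theorem exists_section {A : Type*} [CommRing A] (X : ℤ → Type*) [∀ j, AddCommGroup (X j)]
    [∀ j, Module A (X j)] [∀ j, Module.Projective A (X j)]
    (d : ∀ i : ℤ, X i →ₗ[A] X (i + 1)) (hdd : ∀ i x, d (i + 1) (d i x) = 0)
    (b : ℤ) (hb : ∀ j, b < j → ∀ x : X j, x = 0) (j0 : ℤ)
    (hex : ∀ i, j0 < i + 1 → ∀ x : X (i + 1), d (i + 1) x = 0 → ∃ y, d i y = x) :
    ∃ s : X (j0 + 1) →ₗ[A] X j0, ∀ z, d (j0 + 1) z = 0 → d j0 (s z) = z :=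
  exists_section_aux X d hdd b hb j0 hex (b - j0).toNat j0 (by omega) (by omega)

/-- Nakayama over all maximal ideals. -/
theorem le_of_forall_maximal {A M : Type*} [CommRing A] [AddCommGroup M] [Module A M]
    (Z N : Submodule A M) (hZ : Z.FG)
    (h : ∀ n : Ideal A, n.IsMaximal → Z ≤ N ⊔ n • Z) : Z ≤ N := by
  have hann : (Z.map N.mkQ).annihilator = ⊤ := by
    by_contra hne
    obtain ⟨n, hn, hle⟩ := Ideal.exists_le_maximal _ hne
    have h1 : Z.map N.mkQ ≤ n • Z.map N.mkQ := by
      have := Submodule.map_mono (f := N.mkQ) (h n hn)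
      rw [Submodule.map_sup, Submodule.map_smul''] at this
      simpa using this
    obtain ⟨r, hr, hr0⟩ := Submodule.exists_sub_one_mem_and_smul_eq_zero_of_fg_of_le_smul n _
      (hZ.map _) h1
    have hrn : r ∈ n := hle (Submodule.mem_annihilator.2 hr0)
    apply hn.ne_top
    rw [Ideal.eq_top_iff_one]
    simpa using n.sub_mem hrn hr
  rw [Submodule.annihilator_eq_top_iff] at hann
  intro x hx
  have : N.mkQ x ∈ Z.map N.mkQ := Submodule.mem_map_of_mem hx
  rw [hann] at this
  simpa using this

/-- Descending recursion over `ℤ`. -/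
theorem exists_desc_seq (S : ℤ → Type*) (Rel : ∀ j, S (j + 1) → S j → Prop) (b : ℤ)
    (z : ∀ j, S j) (hz : ∀ j, b ≤ j → Rel j (z (j + 1)) (z j))
    (step : ∀ j s, ∃ s', Rel j s s') :
    ∃ s : ∀ j, S j, (∀ j, Rel j (s (j + 1)) (s j)) ∧ ∀ j, b ≤ j → s j = z j := by
  choose next hnext using step
  let f : ℕ → ∀ j, S j := fun n => Nat.rec z (fun _ F j => next j (F (j + 1))) n
  refine ⟨fun j => f (b - j).toNat j, fun j => ?_, fun j hj => ?_⟩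
  · by_cases hj : b ≤ j
    · have h1 : (b - j).toNat = 0 := by omega
      have h2 : (b - (j + 1)).toNat = 0 := by omega
      simp only [h1, h2]
      exact hz j hj
    · have h1 : (b - j).toNat = (b - (j + 1)).toNat + 1 := by omega
      simp only [h1]
      exact hnext j _
  · have h1 : (b - j).toNat = 0 := by omega
    simp only [h1]; rfl

/-- Residue fields are `k`. -/
theorem exists_const_sub_mem (k : Type*) [Field k] [IsAlgClosed k] {A : Type*} [CommRing A]
    [Algebra k A] [Algebra.FiniteType k A] (n : Ideal A) (hn : n.IsMaximal) (a : A) :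
    ∃ c : k, a - algebraMap k A c ∈ n := by
  letI := Ideal.Quotient.field n
  haveI : Algebra.FiniteType k (A ⧸ n) :=
    Algebra.FiniteType.of_surjective (Ideal.Quotient.mkₐ k n) (Ideal.Quotient.mkₐ_surjective k n)
  haveI : Module.Finite k (A ⧸ n) := finite_of_finite_type_of_isJacobsonRing k (A ⧸ n)
  obtain ⟨c, hc⟩ := (IsAlgClosed.algebraMap_bijective_of_isIntegral (k := k) (K := A ⧸ n)).2
    (Ideal.Quotient.mk n a)
  refine ⟨c, ?_⟩
  rw [← Ideal.Quotient.eq, ← hc]; rfl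

theorem small_of_finiteType (k : Type*) [Field k] {A : Type*} [CommRing A]
    [Algebra k A] [Algebra.FiniteType k A] [Small.{v} k] : Small.{v} A := by
  obtain ⟨n, f, hf⟩ := Algebra.FiniteType.iff_quotient_mvPolynomial''.1
    (inferInstance : Algebra.FiniteType k A)
  haveI : Small.{v} (MvPolynomial (Fin n) k) :=
    ⟨⟨MvPolynomial (Fin n) (Shrink.{v} k),
      ⟨(MvPolynomial.mapEquiv (Fin n) (Shrink.ringEquiv.{v} k)).symm.toEquiv⟩⟩⟩
  exact small_of_surjective hf

section Inv

variable {k : Type*} [Field k] [CharZero k]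
    {A : Type u} [CommRing A] [Algebra k A]
    {G : Type w} [Group G] [MulSemiringAction G A] [SMulCommClass G k A]

instance invAlg_smulComm : SMulCommClass (invAlg k A G) G A :=
  ⟨fun r g a => by
    rw [Subalgebra.smul_def, Subalgebra.smul_def, smul_eq_mul, smul_eq_mul, smul_mul', r.2 g]⟩

instance invAlg_isInvariant : Algebra.IsInvariant (invAlg k A G) A G :=
  ⟨fun a h => ⟨⟨a, h⟩, rfl⟩⟩

variable (k A G) in
theorem invAlg_finite [Finite G] [Algebra.FiniteType k A] :
    Module.Finite (invAlg k A G) A := by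
  haveI := Algebra.IsInvariant.isIntegral (invAlg k A G) A G
  haveI := Algebra.FiniteType.of_restrictScalars_finiteType k (invAlg k A G) A
  exact Algebra.IsIntegral.finite

variable (k A G) in
theorem invAlg_noeth [Finite G] [Algebra.FiniteType k A] :
    IsNoetherianRing (invAlg k A G) := by
  haveI := invAlg_finite k A G
  have h := fg_of_fg_of_fg k (invAlg k A G) A (Algebra.FiniteType.out) (Module.Finite.fg_top)
    Subtype.val_injective
  haveI : Algebra.FiniteType k (invAlg k A G) := ⟨h⟩
  exact Algebra.FiniteType.isNoetherianRing k _

variable {Q : Type*} [AddCommGroup Q] [Module (invAlg k A G) Q]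

theorem gsmul_tensor (g : G) (a : A) (t : A ⊗[invAlg k A G] Q) :
    g • (a • t) = (g • a) • (g • t) := by
  induction t with
  | zero => simp
  | add x y hx hy => simp only [smul_add, hx, hy]
  | tmul x y => simp only [TensorProduct.smul_tmul', smul_eq_mul, smul_mul']

theorem gsmul_baseChange {Q' : Type*} [AddCommGroup Q'] [Module (invAlg k A G) Q']
    (f : Q →ₗ[invAlg k A G] Q') (g : G) (t : A ⊗[invAlg k A G] Q) :
    f.baseChange A (g • t) = g • f.baseChange A t := by
  induction t with
  | zero => simp
  | add x y hx hy => simp only [smul_add, map_add, hx, hy]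
  | tmul x y => simp only [TensorProduct.smul_tmul', LinearMap.baseChange_tmul]

/-- The (unnormalised) trace `A → Aᴳ`. -/
def invTrace [Fintype G] : A →ₗ[invAlg k A G] invAlg k A G where
  toFun a := ⟨∑ g : G, g • a, fun h => by
    rw [Finset.smul_sum]
    simp only [smul_smul]
    exact Fintype.sum_equiv (Equiv.mulLeft h) _ _ (fun _ => rfl)⟩
  map_add' a b := Subtype.ext (by simp [Finset.sum_add_distrib])
  map_smul' r a := Subtype.ext (by
    have h : ∀ g : G, g • (r • a) = r • (g • a) := fun g => (smul_comm r g a).symm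
    simp only [h]
    simp [Finset.mul_sum, Subalgebra.smul_def])

theorem exists_trace [Fintype G] (t : A ⊗[invAlg k A G] Q) :
    ∃ q : Q, ∑ g : G, g • t = 1 ⊗ₜ q := by
  induction t with
  | zero => exact ⟨0, by simp⟩
  | add x y hx hy =>
    obtain ⟨p, hp⟩ := hx
    obtain ⟨q, hq⟩ := hy
    exact ⟨p + q, by simp only [smul_add, Finset.sum_add_distrib, hp, hq, TensorProduct.tmul_add]⟩
  | tmul x y =>
    refine ⟨invTrace (k := k) (G := G) x • y, ?_⟩
    rw [← TensorProduct.smul_tmul, Subalgebra.smul_def]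
    simp only [TensorProduct.smul_tmul', ← TensorProduct.sum_tmul]
    simp [invTrace]

theorem one_tmul_inj [Finite G] (q : Q) (h : (1 : A) ⊗ₜ[invAlg k A G] q = 0) : q = 0 := by
  cases nonempty_fintype G
  have h2 := congrArg ((TensorProduct.lid (invAlg k A G) Q).toLinearMap ∘ₗ
    (invTrace (k := k) (A := A) (G := G)).rTensor Q) h
  have h3 : (invTrace (k := k) (G := G) (1 : A)) = algebraMap k _ (Fintype.card G : k) :=
    Subtype.ext (by simp [invTrace])
  have hu : (Fintype.card G : k) ≠ 0 := by simp
  simp only [LinearMap.comp_apply, LinearMap.rTensor_tmul, map_zero, h3] at h2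
  have h4 : (algebraMap k (invAlg k A G) (Fintype.card G : k)) • q = 0 := by simpa using h2
  have h5 := congrArg (fun x => (algebraMap k (invAlg k A G) (Fintype.card G : k)⁻¹) • x) h4
  simpa only [smul_smul, ← map_mul, inv_mul_cancel₀ hu, map_one, one_smul, smul_zero] using h5

/-- Stabilizers act trivially on the fibers of `A ⊗ Q`. -/
theorem stab_tensor [IsAlgClosed k] [Algebra.FiniteType k A] (n : Ideal A) (hn : n.IsMaximal)
    (g : G) (hg : ∀ a : A, g • a ∈ n ↔ a ∈ n) (t : A ⊗[invAlg k A G] Q) :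
    g • t - t ∈ n • (⊤ : Submodule A (A ⊗[invAlg k A G] Q)) := by
  induction t with
  | zero => simp
  | add x y hx hy =>
    rw [smul_add, add_sub_add_comm]
    exact add_mem hx hy
  | tmul x y =>
    obtain ⟨c, hc⟩ := exists_const_sub_mem k n hn x
    have h1 : g • x - x ∈ n := by
      have := n.sub_mem ((hg _).2 hc) hc
      rw [smul_sub, smul_algebraMap] at this
      simpa using this
    have h2 : g • (x ⊗ₜ[invAlg k A G] y) - x ⊗ₜ y = (g • x - x) • ((1 : A) ⊗ₜ y) := by
      rw [TensorProduct.smul_tmul', ← TensorProduct.sub_tmul, TensorProduct.smul_tmul',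
        smul_eq_mul, mul_one]
    rw [h2]
    exact Submodule.smul_mem_smul h1 trivial

end Inv

section Cone

variable {k : Type*} [Field k] [CharZero k]
    {A : Type u} [CommRing A] [Algebra k A]
    {G : Type w} [Group G] [MulSemiringAction G A] [SMulCommClass G k A]
    (E : EqvModComplex.{u, w, v} A G) (Q : ModComplex.{u, v} ↥(invAlg k A G))
    (φ : ∀ j : ℤ, (A ⊗[invAlg k A G] Q.X j) →ₗ[A] E.X j)

/-- The differential of the (shifted) mapping cone of `φ`. -/
def coneD (i : ℤ) : ((A ⊗[invAlg k A G] Q.X (i + 1)) × E.X i) →ₗ[A]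
    ((A ⊗[invAlg k A G] Q.X (i + 1 + 1)) × E.X (i + 1)) :=
  LinearMap.prod (((Q.d (i + 1) (i + 1 + 1) rfl).baseChange A) ∘ₗ LinearMap.fst _ _ _)
    (φ (i + 1) ∘ₗ LinearMap.fst _ _ _ - E.d i (i + 1) rfl ∘ₗ LinearMap.snd _ _ _)

theorem coneD_apply (i : ℤ) (p : A ⊗[invAlg k A G] Q.X (i + 1)) (e : E.X i) :
    coneD E Q φ i (p, e) = ((Q.d (i + 1) (i + 1 + 1) rfl).baseChange A p,
      φ (i + 1) p - E.d i (i + 1) rfl e) := rfl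

theorem baseChange_dd (i : ℤ) (p : A ⊗[invAlg k A G] Q.X i) :
    (Q.d (i + 1) (i + 1 + 1) rfl).baseChange A ((Q.d i (i + 1) rfl).baseChange A p) = 0 := by
  induction p with
  | zero => simp
  | add x y hx hy => simp only [map_add, hx, hy, add_zero]
  | tmul x y => simp only [LinearMap.baseChange_tmul, Q.d_comp_d, TensorProduct.tmul_zero]

theorem coneD_comp
    (hch : ∀ (i j : ℤ) (h : i + 1 = j) (t : A ⊗[invAlg k A G] Q.X i),
          φ j ((Q.d i j h).baseChange A t) = E.d i j h (φ i t)) (i : ℤ) (x) :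
    coneD E Q φ (i + 1) (coneD E Q φ i x) = 0 := by
  obtain ⟨p, e⟩ := x
  rw [coneD_apply, coneD_apply, baseChange_dd, hch, map_sub, E.d_comp_d]
  simp

/-- Stabilizers preserve `nE`. -/
theorem stab_smul_top (n : Ideal A) (g : G) (hg : ∀ a : A, g • a ∈ n ↔ a ∈ n) (j : ℤ)
    (x : E.X j) (hx : x ∈ n • (⊤ : Submodule A (E.X j))) :
    g • x ∈ n • (⊤ : Submodule A (E.X j)) := by
  refine Submodule.smul_induction_on hx (fun r hr y _ => ?_) (fun y z hy hz => ?_)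
  · rw [E.equivariant]
    exact Submodule.smul_mem_smul ((hg r).2 hr) trivial
  · rw [smul_add]; exact add_mem hy hz

theorem stab_D (n : Ideal A) (g : G) (hg : ∀ a : A, g • a ∈ n ↔ a ∈ n) (i j : ℤ) (h : i + 1 = j)
    (x : E.X j) (hx : x ∈ LinearMap.range (E.d i j h) ⊔ n • (⊤ : Submodule A (E.X j))) :
    g • x ∈ LinearMap.range (E.d i j h) ⊔ n • (⊤ : Submodule A (E.X j)) := by
  obtain ⟨_, ⟨y, rfl⟩, z, hz, rfl⟩ := Submodule.mem_sup.1 hx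
  rw [smul_add, ← E.d_equivariant]
  exact Submodule.add_mem_sup ⟨_, rfl⟩ (stab_smul_top E n g hg j z hz)

theorem map_smul_top_mem {M N : Type*} [AddCommGroup M] [AddCommGroup N] [Module A M] [Module A N]
    (f : M →ₗ[A] N) (n : Ideal A) {x : M} (hx : x ∈ n • (⊤ : Submodule A M)) :
    f x ∈ n • (⊤ : Submodule A N) := by
  have : f x ∈ (n • (⊤ : Submodule A M)).map f := Submodule.mem_map_of_mem hx
  rw [Submodule.map_smul''] at this
  exact Submodule.smul_mono le_rfl le_top this

theorem natCast_smul_cancel (k : Type*) [Field k] [CharZero k] [Algebra k A] {M : Type*}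
    [AddCommGroup M] [Module A M] (D : Submodule A M) (m : ℕ) (hm : m ≠ 0) (x : M)
    (hx : m • x ∈ D) : x ∈ D := by
  have h : x = (algebraMap k A (m : k)⁻¹) • (m • x) := by
    rw [← Nat.cast_smul_eq_nsmul A m x, smul_smul, ← map_natCast (algebraMap k A), ← map_mul,
      inv_mul_cancel₀ (by exact_mod_cast hm), map_one, one_smul]
  rw [h]
  exact D.smul_mem _ hx

/-- Unipotent trick: if `(g - 1)^2 e ∈ D` then `(g - 1) e ∈ D`. -/
theorem unipotent_trick (k : Type*) [Field k] [CharZero k] [Algebra k A] [Finite G]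
    {M : Type*} [AddCommGroup M] [Module A M]
    [DistribMulAction G M] (D : Submodule A M) (g : G) (hD : ∀ x ∈ D, g • x ∈ D) (e : M)
    (h : g • (g • e - e) - (g • e - e) ∈ D) : g • e - e ∈ D := by
  have key : ∀ m : ℕ, g ^ m • e - e - m • (g • e - e) ∈ D := by
    intro m
    induction m with
    | zero => simp
    | succ m ih =>
      have h1 := hD _ ih
      have h2 := D.add_mem h1 (D.smul_of_tower_mem m h)
      convert h2 using 1
      have h4 : g • (g ^ m • e - e - m • (g • e - e)) =
          g • g ^ m • e - g • e - m • (g • (g • e - e)) := by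
        rw [smul_sub g (g ^ m • e - e), smul_sub g (g ^ m • e) e, smul_comm g m (g • e - e)]
      rw [h4, pow_succ', mul_smul, smul_sub m, succ_nsmul]
      abel
  have h3 := key (orderOf g)
  rw [pow_orderOf_eq_one, one_smul, sub_self, zero_sub, neg_mem_iff] at h3
  have hpos := (orderOf_pos g).ne'
  exact natCast_smul_cancel k D (orderOf g) hpos (g • e - e) h3

/-- CRT-type element. -/
theorem exists_crt [Finite G] (n : Ideal A) (hn : n.IsMaximal) :
    ∃ a : A, a - 1 ∈ n ∧ ∀ g : G, ¬ (∀ a : A, g • a ∈ n ↔ a ∈ n) → g • a ∈ n := by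
  classical
  cases nonempty_fintype G
  have h1 : ∀ g : G, ∃ b : A, b - 1 ∈ n ∧
      (¬ (∀ a : A, g • a ∈ n ↔ a ∈ n) → g • b ∈ n) := by
    intro g
    by_cases hg : ∀ a : A, g • a ∈ n ↔ a ∈ n
    · exact ⟨1, by simp, fun h => absurd hg h⟩
    · let f : A →+* A := MulSemiringAction.toRingHom G A g
      have hf : Function.Surjective f := fun x => ⟨g⁻¹ • x, smul_inv_smul g x⟩
      have hm : (n.comap f).IsMaximal := Ideal.comap_isMaximal_of_surjective f hf
      have hne : n.comap f ≠ n := by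
        intro h
        apply hg
        intro a
        conv_rhs => rw [← h]
        rfl
      have hc := Ideal.isCoprime_iff_exists.1 (Ideal.isCoprime_of_isMaximal hne)
      obtain ⟨x, hx, y, hy, hxy⟩ := hc
      refine ⟨x, ?_, fun _ => hx⟩
      have : x - 1 = -y := by rw [← hxy]; ring
      rw [this]; exact n.neg_mem hy
  choose b hb1 hb2 using h1
  refine ⟨∏ g, b g, ?_, fun g hg => ?_⟩
  · rw [← Ideal.Quotient.eq, map_prod]
    have : ∀ g, Ideal.Quotient.mk n (b g) = 1 := fun g => by
      have := Ideal.Quotient.eq.2 (hb1 g)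
      simpa using this
    simp [this]
  · rw [Finset.smul_prod']
    exact Ideal.mem_of_dvd n (Finset.dvd_prod_of_mem _ (Finset.mem_univ g)) (hb2 g hg)

theorem smul_sub_aux {M : Type*} [AddCommGroup M] [Module A M] (c : A) (x y : M) :
    c • x - y = (c - 1) • x + (x - y) := by
  rw [sub_smul, one_smul]; abel

/-- The induction step: exactness of the cone at `j = l + 1`. -/
theorem cone_exact_step [IsAlgClosed k] [Algebra.FiniteType k A] [Finite G]
    (hproj : ∀ j, Module.Projective A (E.X j))
    (hfin : ∀ j, Module.Finite A (E.X j))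
    (b : ℤ) (hb : ∀ j, b < j → ∀ x : E.X j, x = 0)
    (hQproj : ∀ j, Module.Projective (invAlg k A G) (Q.X j))
    (hQfin : ∀ j, Module.Finite (invAlg k A G) (Q.X j))
    (hQb : ∀ j, b < j → ∀ x : Q.X j, x = 0)
    (hch : ∀ (i j : ℤ) (h : i + 1 = j) (t : A ⊗[invAlg k A G] Q.X i),
          φ j ((Q.d i j h).baseChange A t) = E.d i j h (φ i t))
    (heq : ∀ (j : ℤ) (g : G) (t : A ⊗[invAlg k A G] Q.X j), φ j (g • t) = g • φ j t)
    (hK : ∀ (j : ℤ) (q : Q.X (j + 1)) (e : E.X j), Q.d (j + 1) (j + 1 + 1) rfl q = 0 →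
      (∀ g : G, g • e = e) → φ (j + 1) (1 ⊗ₜ q) = E.d j (j + 1) rfl e →
      ∃ x : Q.X j, Q.d j (j + 1) rfl x = q ∧ φ j (1 ⊗ₜ x) = e)
    (hst : ∀ n : Ideal A, n.IsMaximal → ∀ (l : ℤ) (x : E.X (l + 1)),
      E.d (l + 1) (l + 1 + 1) rfl x ∈ n • (⊤ : Submodule A (E.X (l + 1 + 1))) →
      ∀ g : G, (∀ a : A, g • a ∈ n ↔ a ∈ n) →
        g • x - x ∈ LinearMap.range (E.d l (l + 1) rfl) ⊔
          n • (⊤ : Submodule A (E.X (l + 1))))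
    (l : ℤ)
    (hex : ∀ i, l + 1 < i + 1 → ∀ x, coneD E Q φ (i + 1) x = 0 → ∃ y, coneD E Q φ i y = x) :
    ∀ x, coneD E Q φ (l + 1) x = 0 → ∃ y, coneD E Q φ l y = x := by
  classical
  cases nonempty_fintype G
  have := fun i => hproj i
  have := fun i => hfin i
  have := fun i => hQproj i
  have := fun i => hQfin i
  haveI : IsNoetherianRing A := Algebra.FiniteType.isNoetherianRing k A
  obtain ⟨s, hs⟩ := exists_section
    (fun i => (A ⊗[invAlg k A G] Q.X (i + 1)) × E.X i) (coneD E Q φ)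
    (coneD_comp E Q φ hch) b (fun j hj x => by
      obtain ⟨p, e⟩ := x
      have hp : p = 0 := by
        induction p with
        | zero => rfl
        | add x y hx hy => rw [hx, hy, add_zero]
        | tmul x y => rw [hQb _ (by omega) y, TensorProduct.tmul_zero]
      rw [hp, hb j hj e]; rfl) (l + 1) hex
  have hdd := coneD_comp E Q φ hch
  suffices h : LinearMap.ker (coneD E Q φ (l + 1)) ≤ LinearMap.range (coneD E Q φ l) from
    fun x hx => h hx
  refine le_of_forall_maximal _ _ (IsNoetherian.noetherian _) (fun n hn z hz => ?_)
  -- first: `z ∈ range ⊔ n • ⊤`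
  have hW : z ∈ LinearMap.range (coneD E Q φ l) ⊔ n • ⊤ := by
    obtain ⟨p, e⟩ := z
    have hz' := LinearMap.mem_ker.1 hz
    rw [coneD_apply, Prod.mk_eq_zero, sub_eq_zero] at hz'
    obtain ⟨hp, hpe⟩ := hz'
    set W := LinearMap.range (coneD E Q φ l) ⊔ n • ⊤ with hWdef
    have hstab : ∀ g : G, (∀ a : A, g • a ∈ n ↔ a ∈ n) → (g • p, g • e) - (p, e) ∈ W := by
      intro g hg
      have h1 := stab_tensor n hn g hg p
      have h2 : g • e - e ∈ LinearMap.range (E.d l (l + 1) rfl) ⊔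
          n • (⊤ : Submodule A (E.X (l + 1))) := by
        refine unipotent_trick k _ g (fun x hx => stab_D E n g hg _ _ _ x hx) e ?_
        refine hst n hn l _ ?_ g hg
        rw [map_sub, E.d_equivariant, ← hpe, ← heq, ← map_sub]
        exact map_smul_top_mem _ n h1
      obtain ⟨_, ⟨u, rfl⟩, y, hy, huy⟩ := Submodule.mem_sup.1 h2
      have h3 : (g • p, g • e) - (p, e) = coneD E Q φ l (0, -u) +
          (LinearMap.inl A _ _ (g • p - p) + LinearMap.inr A _ _ y) := by
        rw [coneD_apply, Prod.mk_sub_mk, ← huy]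
        simp
      rw [h3]
      exact Submodule.add_mem_sup ⟨_, rfl⟩
        (add_mem (map_smul_top_mem _ n h1) (map_smul_top_mem _ n hy))
    obtain ⟨a, ha1, ha2⟩ := exists_crt (G := G) n hn
    have hterm : ∀ g : G, (g • (a • p), g • (a • e)) -
        (if (∀ a : A, g • a ∈ n ↔ a ∈ n) then (p, e) else 0) ∈ W := by
      intro g
      have h0 : (g • (a • p), g • (a • e)) = (g • a) • (g • p, g • e) := by
        rw [gsmul_tensor, E.equivariant]; rfl
      rw [h0]
      split_ifs with hg
      · have h1 : (g • a) • (g • p, g • e) - (p, e) =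
            (g • a - 1) • (g • p, g • e) + ((g • p, g • e) - (p, e)) :=
          smul_sub_aux _ _ _
        rw [h1]
        refine add_mem (Submodule.mem_sup_right (Submodule.smul_mem_smul ?_ trivial)) (hstab g hg)
        have := (hg _).2 ha1
        rwa [smul_sub, smul_one] at this
      · rw [sub_zero]
        exact Submodule.mem_sup_right (Submodule.smul_mem_smul (ha2 g hg) trivial)
    have hsum := Submodule.sum_mem W (t := Finset.univ) (fun g _ => hterm g)
    rw [Finset.sum_sub_distrib, ← Finset.sum_filter, Finset.sum_const] at hsum
    have hinv : ∑ g : G, (g • (a • p), g • (a • e)) ∈ W := by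
      obtain ⟨q, hq⟩ := exists_trace (k := k) (G := G) (a • p)
      have hsp : ∑ g : G, (g • (a • p), g • (a • e)) =
          (1 ⊗ₜ q, ∑ g : G, g • (a • e)) := by
        rw [← hq]
        exact Prod.ext (by simp [Prod.fst_sum]) (by simp [Prod.snd_sum])
      have hdq : Q.d (l + 1 + 1) (l + 1 + 1 + 1) rfl q = 0 := by
        apply one_tmul_inj (k := k) (A := A) (G := G)
        rw [← LinearMap.baseChange_tmul, ← hq, map_sum]
        refine Finset.sum_eq_zero fun g _ => ?_
        rw [gsmul_baseChange, map_smul, hp, smul_zero, smul_zero]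
      obtain ⟨x, hx1, hx2⟩ := hK (l + 1) q (∑ g : G, g • (a • e)) hdq (fun h => by
          rw [Finset.smul_sum]
          simp only [smul_smul h]
          exact Fintype.sum_equiv (Equiv.mulLeft h) _ _ (fun _ => rfl)) (by
          rw [← hq, map_sum, map_sum]
          refine Finset.sum_congr rfl fun g _ => ?_
          rw [heq, E.d_equivariant, map_smul, map_smul, hpe])
      rw [hsp]
      refine Submodule.mem_sup_left ⟨(1 ⊗ₜ x, 0), ?_⟩
      rw [coneD_apply, LinearMap.baseChange_tmul, hx1, hx2, map_zero, sub_zero]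
    have h5 := W.sub_mem hinv hsum
    rw [sub_sub_cancel] at h5
    refine natCast_smul_cancel k W _ ?_ _ h5
    apply Finset.card_ne_zero_of_mem (a := (1 : G))
    simp
  obtain ⟨_, ⟨u, rfl⟩, y, hy, rfl⟩ := Submodule.mem_sup.1 hW
  refine Submodule.add_mem_sup ⟨_, rfl⟩ ?_
  have hyz : coneD E Q φ (l + 1) y = 0 := by
    have := LinearMap.mem_ker.1 hz
    rwa [map_add, hdd, zero_add] at this
  let π := LinearMap.id - s ∘ₗ coneD E Q φ (l + 1)
  have hπy : π y = y := by simp [π, hyz]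
  have h6 : π y ∈ (n • (⊤ : Submodule A _)).map π := Submodule.mem_map_of_mem hy
  rw [Submodule.map_smul'', hπy] at h6
  refine Submodule.smul_mono le_rfl ?_ h6
  rintro _ ⟨x, -, rfl⟩
  simp [π, hs _ (hdd _ _)]

/-- The cone is exact. -/
theorem cone_exact_all [IsAlgClosed k] [Algebra.FiniteType k A] [Finite G]
    (hproj : ∀ j, Module.Projective A (E.X j))
    (hfin : ∀ j, Module.Finite A (E.X j))
    (b : ℤ) (hb : ∀ j, b < j → ∀ x : E.X j, x = 0)
    (hQproj : ∀ j, Module.Projective (invAlg k A G) (Q.X j))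
    (hQfin : ∀ j, Module.Finite (invAlg k A G) (Q.X j))
    (hQb : ∀ j, b < j → ∀ x : Q.X j, x = 0)
    (hch : ∀ (i j : ℤ) (h : i + 1 = j) (t : A ⊗[invAlg k A G] Q.X i),
          φ j ((Q.d i j h).baseChange A t) = E.d i j h (φ i t))
    (heq : ∀ (j : ℤ) (g : G) (t : A ⊗[invAlg k A G] Q.X j), φ j (g • t) = g • φ j t)
    (hK : ∀ (j : ℤ) (q : Q.X (j + 1)) (e : E.X j), Q.d (j + 1) (j + 1 + 1) rfl q = 0 →
      (∀ g : G, g • e = e) → φ (j + 1) (1 ⊗ₜ q) = E.d j (j + 1) rfl e →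
      ∃ x : Q.X j, Q.d j (j + 1) rfl x = q ∧ φ j (1 ⊗ₜ x) = e)
    (hst : ∀ n : Ideal A, n.IsMaximal → ∀ (l : ℤ) (x : E.X (l + 1)),
      E.d (l + 1) (l + 1 + 1) rfl x ∈ n • (⊤ : Submodule A (E.X (l + 1 + 1))) →
      ∀ g : G, (∀ a : A, g • a ∈ n ↔ a ∈ n) →
        g • x - x ∈ LinearMap.range (E.d l (l + 1) rfl) ⊔
          n • (⊤ : Submodule A (E.X (l + 1)))) :
    ∀ (i : ℤ) (x), coneD E Q φ (i + 1) x = 0 → ∃ y, coneD E Q φ i y = x := by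
  have key : ∀ (m : ℕ) (i : ℤ), b ≤ i + m →
      ∀ (x), coneD E Q φ (i + 1) x = 0 → ∃ y, coneD E Q φ i y = x := by
    intro m
    induction m with
    | zero =>
      intro i hi x hx0
      clear hx0
      obtain ⟨p, e⟩ := x
      have hp : p = 0 := by
        induction p with
        | zero => rfl
        | add x y hx hy => rw [hx, hy, add_zero]
        | tmul x y => rw [hQb _ (by push_cast at hi; omega) y, TensorProduct.tmul_zero]
      refine ⟨0, ?_⟩
      rw [hp, hb (i + 1) (by push_cast at hi; omega) e, map_zero]; rfl
    | succ m ih =>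
      intro i hi
      refine cone_exact_step E Q φ hproj hfin b hb hQproj hQfin hQb hch heq hK hst i ?_
      intro i' hi'
      exact ih i' (by push_cast at hi; omega)
  exact fun i => key (b - i).toNat i (by omega)

/-- Exactness of the cone gives triviality of the stabilizer actions. -/
theorem stab_of_cone_exact [IsAlgClosed k] [Algebra.FiniteType k A]
    (hproj : ∀ j, Module.Projective A (E.X j))
    (b : ℤ) (hb : ∀ j, b < j → ∀ x : E.X j, x = 0)
    (hQproj : ∀ j, Module.Projective (invAlg k A G) (Q.X j))
    (hQb : ∀ j, b < j → ∀ x : Q.X j, x = 0)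
    (hch : ∀ (i j : ℤ) (h : i + 1 = j) (t : A ⊗[invAlg k A G] Q.X i),
          φ j ((Q.d i j h).baseChange A t) = E.d i j h (φ i t))
    (heq : ∀ (j : ℤ) (g : G) (t : A ⊗[invAlg k A G] Q.X j), φ j (g • t) = g • φ j t)
    (hex : ∀ (i : ℤ) (x), coneD E Q φ (i + 1) x = 0 → ∃ y, coneD E Q φ i y = x)
    (n : Ideal A) (hn : n.IsMaximal) (l : ℤ) (x : E.X (l + 1))
    (hx : E.d (l + 1) (l + 1 + 1) rfl x ∈ n • (⊤ : Submodule A (E.X (l + 1 + 1))))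
    (g : G) (hg : ∀ a : A, g • a ∈ n ↔ a ∈ n) :
    g • x - x ∈ LinearMap.range (E.d l (l + 1) rfl) ⊔
          n • (⊤ : Submodule A (E.X (l + 1))) := by
  have := fun i => hproj i
  have := fun i => hQproj i
  have hdd := coneD_comp E Q φ hch
  obtain ⟨s, hs⟩ := exists_section
    (fun i => (A ⊗[invAlg k A G] Q.X (i + 1)) × E.X i) (coneD E Q φ)
    (coneD_comp E Q φ hch) b (fun j hj x => by
      obtain ⟨p, e⟩ := x
      have hp : p = 0 := by
        induction p with
        | zero => rfl
        | add x y hx hy => rw [hx, hy, add_zero]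
        | tmul x y => rw [hQb _ (by omega) y, TensorProduct.tmul_zero]
      rw [hp, hb j hj e]; rfl) (l + 1) (fun i _ => hex i)
  have h1 : coneD E Q φ (l + 1) (0, x) ∈ n • (⊤ : Submodule A _) := by
    have : coneD E Q φ (l + 1) (0, x) = - LinearMap.inr A _ _ (E.d (l + 1) (l + 1 + 1) rfl x) := by
      rw [coneD_apply]; simp
    rw [this]
    exact neg_mem (map_smul_top_mem _ n hx)
  have h2 := map_smul_top_mem s n h1
  set y := s (coneD E Q φ (l + 1) (0, x)) with hy
  obtain ⟨⟨t, u⟩, htu⟩ := hex l ((0, x) - y) (by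
    rw [map_sub, hy, hs _ (hdd _ _), sub_self])
  have h3 := map_smul_top_mem (LinearMap.snd A _ _) n h2
  have h4 := congrArg Prod.snd htu
  rw [coneD_apply] at h4
  have hxe : x = φ (l + 1) t + (E.d l (l + 1) rfl (-u) + y.2) := by
    rw [map_neg]
    have : φ (l + 1) t - E.d l (l + 1) rfl u = x - y.2 := h4
    rw [← add_assoc, ← sub_eq_add_neg, this]; abel
  have hD : E.d l (l + 1) rfl (-u) + y.2 ∈ LinearMap.range (E.d l (l + 1) rfl) ⊔
          n • (⊤ : Submodule A (E.X (l + 1))) := Submodule.add_mem_sup ⟨_, rfl⟩ h3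
  have hgD := stab_D E n g hg _ _ _ _ hD
  have ht : g • φ (l + 1) t - φ (l + 1) t ∈ LinearMap.range (E.d l (l + 1) rfl) ⊔
          n • (⊤ : Submodule A (E.X (l + 1))) := by
    rw [← heq, ← map_sub]
    exact Submodule.mem_sup_right (map_smul_top_mem _ n (stab_tensor n hn g hg t))
  rw [hxe, smul_add, add_sub_add_comm]
  exact add_mem ht (sub_mem hgD hD)

end Cone

/-- One stage of the construction of the resolution. -/
structure ResSt.{s, r} (R : Type s) [CommRing R] (M : Type r) [AddCommGroup M] [Module R M] :
    Type (max s (r + 1)) where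
  X : Type r
  [acg : AddCommGroup X]
  [mod : Module R X]
  fin : Module.Finite R X
  proj : Module.Projective R X
  Z : Submodule R X
  φ : X →ₗ[R] M

attribute [instance] ResSt.acg ResSt.mod

section Res

variable {k : Type*} [Field k] [CharZero k]
    {A : Type u} [CommRing A] [Algebra k A]
    {G : Type w} [Group G] [MulSemiringAction G A] [SMulCommClass G k A]
    (E : EqvModComplex.{u, w, v} A G)

variable (k) in
/-- Compatibility of consecutive stages. -/
def ResRel (j : ℤ) (s : ResSt (invAlg k A G) (E.X (j + 1))) (s' : ResSt (invAlg k A G) (E.X j)) :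
    Prop :=
  ∃ d : s'.X →ₗ[invAlg k A G] s.X, (∀ x, d x ∈ s.Z) ∧
    (∀ x, s.φ (d x) = E.d j (j + 1) rfl (s'.φ x)) ∧
    (∀ x (g : G), g • s'.φ x = s'.φ x) ∧
    s'.Z = LinearMap.ker d ∧
    (∀ q ∈ s.Z, ∀ e, (∀ g : G, g • e = e) → s.φ q = E.d j (j + 1) rfl e →
      ∃ x, d x = q ∧ s'.φ x = e)

theorem resRel_step [Algebra.FiniteType k A] [Finite G] [Small.{v} A]
    (hfin : ∀ j, Module.Finite A (E.X j)) (j : ℤ) (s : ResSt (invAlg k A G) (E.X (j + 1))) :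
    ∃ s', ResRel k E j s s' := by
  have := invAlg_noeth k A G
  have := invAlg_finite k A G
  have := hfin j
  have : Module.Finite (invAlg k A G) (E.X j) := Module.Finite.trans A _
  have := s.fin
  let K : Submodule (invAlg k A G) (s.X × E.X j) :=
    { carrier := {x | x.1 ∈ s.Z ∧ (∀ g : G, g • x.2 = x.2) ∧ s.φ x.1 = E.d j (j + 1) rfl x.2}
      zero_mem' := by simp
      add_mem' := by
        rintro ⟨a, b⟩ ⟨c, d⟩ ⟨h1, h2, h3⟩ ⟨h1', h2', h3'⟩
        refine ⟨add_mem h1 h1', fun g => ?_, ?_⟩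
        · exact (smul_add g b d).trans (by rw [h2 g, h2' g]; rfl)
        · exact (map_add s.φ a c).trans ((congrArg₂ (· + ·) h3 h3').trans (map_add _ b d).symm)
      smul_mem' := by
        rintro r ⟨a, b⟩ ⟨h1, h2, h3⟩
        refine ⟨s.Z.smul_mem r h1, fun g => ?_, ?_⟩
        · show g • ((r : A) • b) = (r : A) • b
          rw [E.equivariant, r.2 g, h2 g]
        · exact (map_smul s.φ r a).trans ((congrArg (r • ·) h3).trans
            (map_smul (E.d j (j + 1) rfl) (r : A) b).symm) }
  obtain ⟨m, f, hf⟩ := Module.Finite.exists_fin' (invAlg k A G) K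
  let e : (Fin m → Shrink.{v} (invAlg k A G)) ≃ₗ[invAlg k A G] (Fin m → invAlg k A G) :=
    LinearEquiv.piCongrRight fun _ => Shrink.linearEquiv _ _
  let F : (Fin m → Shrink.{v} (invAlg k A G)) →ₗ[invAlg k A G] (s.X × E.X j) :=
    K.subtype ∘ₗ f ∘ₗ e.toLinearMap
  have hF : ∀ x, F x ∈ K := fun x => (f (e x)).2
  refine ⟨{ X := Fin m → Shrink.{v} (invAlg k A G)
            fin := inferInstance
            proj := inferInstance
            Z := LinearMap.ker (LinearMap.fst _ _ _ ∘ₗ F)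
            φ := LinearMap.snd _ _ _ ∘ₗ F }, LinearMap.fst _ _ _ ∘ₗ F,
          fun x => (hF x).1, fun x => (hF x).2.2, fun x => (hF x).2.1, rfl, ?_⟩
  intro q hq y hy hqy
  obtain ⟨x, hx⟩ := hf ⟨(q, y), hq, hy, hqy⟩
  have hFx : F (e.symm x) = (q, y) := by simp [F, hx]
  exact ⟨e.symm x, congrArg Prod.fst hFx, congrArg Prod.snd hFx⟩

/-- Existence of the resolution of `Eᴳ`. -/
theorem exists_resolution [Algebra.FiniteType k A] [Finite G] [Small.{v} A]
    (hfin : ∀ j, Module.Finite A (E.X j))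
    (b : ℤ) (hb : ∀ j, b < j → ∀ x : E.X j, x = 0) :
    ∃ (Q : ModComplex.{u, v} ↥(invAlg k A G))
      (φ : ∀ j : ℤ, (A ⊗[invAlg k A G] Q.X j) →ₗ[A] E.X j),
      (∀ j, Module.Projective (invAlg k A G) (Q.X j)) ∧
      (∀ j, Module.Finite (invAlg k A G) (Q.X j)) ∧
      (∀ j, b < j → ∀ x : Q.X j, x = 0) ∧
      (∀ (i j : ℤ) (h : i + 1 = j) (t : A ⊗[invAlg k A G] Q.X i),
          φ j ((Q.d i j h).baseChange A t) = E.d i j h (φ i t)) ∧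
      (∀ (j : ℤ) (g : G) (t : A ⊗[invAlg k A G] Q.X j), φ j (g • t) = g • φ j t) ∧
      (∀ (j : ℤ) (q : Q.X (j + 1)) (e : E.X j), Q.d (j + 1) (j + 1 + 1) rfl q = 0 →
        (∀ g : G, g • e = e) → φ (j + 1) (1 ⊗ₜ q) = E.d j (j + 1) rfl e →
        ∃ x : Q.X j, Q.d j (j + 1) rfl x = q ∧ φ j (1 ⊗ₜ x) = e) := by
  obtain ⟨s, hs, hsz⟩ := exists_desc_seq (fun j => ResSt (invAlg k A G) (E.X j)) (ResRel k E)
    (b + 1) (fun j => { X := PUnit, fin := inferInstance, proj := inferInstance, Z := ⊤, φ := 0 })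
    (fun j hj => ⟨0, fun _ => trivial, fun x => by simp, fun x g => by simp, by simp,
      fun q _ e _ _ => ⟨0, rfl, (hb j (by omega) e).symm ▸ rfl⟩⟩)
    (resRel_step E hfin)
  choose d hd1 hd2 hd3 hd4 hd5 using hs
  let Q : ModComplex.{u, v} ↥(invAlg k A G) :=
    { X := fun j => (s j).X
      d := fun i j h => by subst h; exact d i
      d_comp_d := fun i j l hij hjl x => by
        subst hij; subst hjl
        have := hd1 i x
        rw [hd4 (i + 1)] at this
        exact this }
  refine ⟨Q, fun j => LinearMap.liftBaseChange A (s j).φ, fun j => (s j).proj,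
    fun j => (s j).fin, ?_, ?_, ?_, ?_⟩
  · intro j hj
    show ∀ x : (s j).X, x = 0
    rw [hsz j (by omega)]
    exact fun _ => rfl
  · intro i j h t
    subst h
    induction t with
    | zero => simp
    | add x y hx hy => simp only [map_add, hx, hy]
    | tmul x y =>
      rw [LinearMap.baseChange_tmul, LinearMap.liftBaseChange_tmul, LinearMap.liftBaseChange_tmul,
        map_smul]
      exact congrArg (x • ·) (hd2 i y)
  · intro j g t
    induction t with
    | zero => simp
    | add x y hx hy => simp only [map_add, smul_add, hx, hy]
    | tmul x y =>
      rw [TensorProduct.smul_tmul', LinearMap.liftBaseChange_tmul, LinearMap.liftBaseChange_tmul,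
        E.equivariant, hd3 j y g]
  · intro j q e hq he hqe
    rw [LinearMap.liftBaseChange_tmul, one_smul] at hqe
    obtain ⟨x, hx1, hx2⟩ := hd5 j q (by rw [hd4 (j + 1)]; exact hq) e he hqe
    refine ⟨x, hx1, ?_⟩
    rw [LinearMap.liftBaseChange_tmul, one_smul, hx2]

end Res

end Helpers

/-- **Descent criterion for equivariant complexes over an algebraically
closed field**: `E` is equivariantly quasi-isomorphic to a complex pulled
back from `Spec Aᴳ` iff the stabilizers act trivially on all cohomology
modules of all fibers of `E` at maximal ideals. -/
theorem complex_descends_iff_stabilizers_act_trivially_on_fiber_cohomology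
    (k : Type*) [Field k] [CharZero k] [IsAlgClosed k]
    (A : Type u) [CommRing A] [Algebra k A] [Algebra.FiniteType k A]
    (G : Type w) [Group G] [Finite G] [MulSemiringAction G A] [SMulCommClass G k A]
    (E : EqvModComplex.{u, w, v} A G)
    (hproj : ∀ j, Module.Projective A (E.X j))
    (hfin : ∀ j, Module.Finite A (E.X j))
    (hbdd : ∃ b : ℤ, ∀ j, b < j → ∀ x : E.X j, x = 0) :
    (∃ Q : ModComplex.{u, v} ↥(invAlg k A G),
      (∀ j, Module.Projective (invAlg k A G) (Q.X j)) ∧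
      (∃ b : ℤ, ∀ j, b < j → ∀ x : Q.X j, x = 0) ∧
      ∃ φ : ∀ j : ℤ, (A ⊗[invAlg k A G] Q.X j) →ₗ[A] E.X j,
        -- `φ` is a chain map from `A ⊗[Aᴳ] Q` to `E`
        (∀ (i j : ℤ) (h : i + 1 = j) (t : A ⊗[invAlg k A G] Q.X i),
          φ j ((Q.d i j h).baseChange A t) = E.d i j h (φ i t)) ∧
        -- `φ` is `G`-equivariant (`G` acting through the factor `A`)
        (∀ (j : ℤ) (g : G) (a : A) (x : Q.X j),
          φ j ((g • a) ⊗ₜ x) = g • φ j (a ⊗ₜ x)) ∧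
        -- `φ` is a quasi-isomorphism: surjective on cohomology ...
        (∀ (j : ℤ) (y : E.X j), E.d j (j+1) rfl y = 0 →
          ∃ t : A ⊗[invAlg k A G] Q.X j, (Q.d j (j+1) rfl).baseChange A t = 0 ∧
            ∃ b : E.X (j-1), E.d (j-1) j (by omega) b = y - φ j t) ∧
        -- ... and injective on cohomology
        (∀ (j : ℤ) (t : A ⊗[invAlg k A G] Q.X j),
          (Q.d j (j+1) rfl).baseChange A t = 0 →
          (∃ b : E.X (j-1), E.d (j-1) j (by omega) b = φ j t) →
          ∃ s : A ⊗[invAlg k A G] Q.X (j-1),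
            (Q.d (j-1) j (by omega)).baseChange A s = t))
    ↔
    (∀ n : Ideal A, n.IsMaximal → ∀ (j : ℤ) (x : E.X j),
      E.d j (j+1) rfl x ∈ n • (⊤ : Submodule A (E.X (j+1))) →
      ∀ g : G, (∀ a : A, g • a ∈ n ↔ a ∈ n) →
        g • x - x ∈ LinearMap.range (E.d (j-1) j (by omega)) ⊔
          n • (⊤ : Submodule A (E.X j))) := by
  obtain ⟨b, hb⟩ := hbdd
  constructor
  · rintro ⟨Q, hQproj, ⟨b', hb'⟩, φ, hch, heq, hsurj, hinj⟩
    have heq' : ∀ (j : ℤ) (g : G) (t : A ⊗[invAlg k A G] Q.X j), φ j (g • t) = g • φ j t := by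
      intro j g t
      induction t with
      | zero => simp
      | add x y hx hy => simp only [map_add, smul_add, hx, hy]
      | tmul x y => rw [TensorProduct.smul_tmul', heq]
    have hsurj' : ∀ (l j : ℤ) (hl : l + 1 = j) (y : E.X j), E.d j (j + 1) rfl y = 0 →
          ∃ t : A ⊗[invAlg k A G] Q.X j, (Q.d j (j + 1) rfl).baseChange A t = 0 ∧
            ∃ b : E.X l, E.d l j hl b = y - φ j t := by
      intro l j hl
      obtain rfl : l = j - 1 := by omega
      exact hsurj j
    have hinj' : ∀ (l j : ℤ) (hl : l + 1 = j) (t : A ⊗[invAlg k A G] Q.X j),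
          (Q.d j (j + 1) rfl).baseChange A t = 0 →
          (∃ b : E.X l, E.d l j hl b = φ j t) →
          ∃ s : A ⊗[invAlg k A G] Q.X l, (Q.d l j hl).baseChange A s = t := by
      intro l j hl
      obtain rfl : l = j - 1 := by omega
      exact hinj j
    have hex : ∀ (i : ℤ) (x), coneD E Q φ (i + 1) x = 0 → ∃ y, coneD E Q φ i y = x := by
      rintro i ⟨p, e⟩ hx
      rw [coneD_apply, Prod.mk_eq_zero, sub_eq_zero] at hx
      obtain ⟨s, hs⟩ := hinj' (i + 1) (i + 1 + 1) rfl p hx.1 ⟨e, hx.2.symm⟩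
      obtain ⟨t, ht, c, hc⟩ := hsurj' i (i + 1) rfl (e - φ (i + 1) s) (by
        rw [map_sub, ← hch, hs, hx.2, sub_self])
      refine ⟨(s + t, -c), ?_⟩
      rw [coneD_apply, map_add, hs, ht, add_zero, map_neg, hc, map_add]
      congr 1
      abel
    have main := stab_of_cone_exact E Q φ hproj (max b b')
      (fun j hj => hb j ((le_max_left _ _).trans_lt hj)) hQproj
      (fun j hj => hb' j ((le_max_right _ _).trans_lt hj)) hch heq' hex
    intro n hn
    have : ∀ (l j : ℤ) (hl : l + 1 = j) (x : E.X j),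
        E.d j (j + 1) rfl x ∈ n • (⊤ : Submodule A (E.X (j + 1))) →
        ∀ g : G, (∀ a : A, g • a ∈ n ↔ a ∈ n) →
        g • x - x ∈ LinearMap.range (E.d l j hl) ⊔ n • (⊤ : Submodule A (E.X j)) := by
      intro l j hl
      subst hl
      exact main n hn l
    exact fun j => this (j - 1) j _
  · intro hst
    by_cases hsm : Small.{v} A
    · obtain ⟨Q, φ, hQproj, hQfin, hQb, hch, heq, hK⟩ := exists_resolution (k := k) E hfin b hb
      have hst' : ∀ n : Ideal A, n.IsMaximal → ∀ (l : ℤ) (x : E.X (l + 1)),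
          E.d (l + 1) (l + 1 + 1) rfl x ∈ n • (⊤ : Submodule A (E.X (l + 1 + 1))) →
          ∀ g : G, (∀ a : A, g • a ∈ n ↔ a ∈ n) →
            g • x - x ∈ LinearMap.range (E.d l (l + 1) rfl) ⊔
              n • (⊤ : Submodule A (E.X (l + 1))) := by
        intro n hn
        have : ∀ (l j : ℤ) (hl : l + 1 = j) (x : E.X j),
            E.d j (j + 1) rfl x ∈ n • (⊤ : Submodule A (E.X (j + 1))) →
            ∀ g : G, (∀ a : A, g • a ∈ n ↔ a ∈ n) →
            g • x - x ∈ LinearMap.range (E.d l j hl) ⊔ n • (⊤ : Submodule A (E.X j)) := by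
          intro l j hl
          obtain rfl : l = j - 1 := by omega
          exact hst n hn j
        exact fun l => this l (l + 1) rfl
      have hex := cone_exact_all E Q φ hproj hfin b hb hQproj hQfin hQb hch heq hK hst'
      refine ⟨Q, hQproj, ⟨b, hQb⟩, φ, hch, ?_, ?_, ?_⟩
      · intro j g a x
        rw [← heq, TensorProduct.smul_tmul']
      · have : ∀ (l j : ℤ) (hl : l + 1 = j) (y : E.X j), E.d j (j + 1) rfl y = 0 →
          ∃ t : A ⊗[invAlg k A G] Q.X j, (Q.d j (j + 1) rfl).baseChange A t = 0 ∧
            ∃ b : E.X l, E.d l j hl b = y - φ j t := by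
          intro l j hl y hy
          subst hl
          obtain ⟨⟨t, c⟩, htc⟩ := hex l (0, y) (by rw [coneD_apply]; simp [hy])
          rw [coneD_apply, Prod.mk.injEq] at htc
          refine ⟨t, htc.1, -c, ?_⟩
          rw [map_neg, ← htc.2]; abel
        exact fun j => this (j - 1) j _
      · have : ∀ (l j : ℤ) (hl : l + 1 = j) (t : A ⊗[invAlg k A G] Q.X j),
          (Q.d j (j + 1) rfl).baseChange A t = 0 →
          (∃ b : E.X l, E.d l j hl b = φ j t) →
          ∃ s : A ⊗[invAlg k A G] Q.X l, (Q.d l j hl).baseChange A s = t := by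
          rintro l j hl t ht ⟨c, hc⟩
          obtain ⟨l, rfl⟩ : ∃ m, l = m + 1 := ⟨l - 1, by omega⟩
          subst hl
          obtain ⟨⟨s, u⟩, hsu⟩ := hex l (t, c) (by rw [coneD_apply, ht, hc, sub_self]; rfl)
          rw [coneD_apply, Prod.mk.injEq] at hsu
          exact ⟨s, hsu.1⟩
        exact fun j => this (j - 1) j _
    · have hzero : ∀ j (x : E.X j), x = 0 := by
        intro j x
        by_contra hx
        apply hsm
        have hinj : Function.Injective (fun c : k => (algebraMap k A c) • x) := by
          intro c c' h
          by_contra hne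
          have h1 : algebraMap k A (c - c') • x = 0 := by
            rw [map_sub, sub_smul, sub_eq_zero]; exact h
          apply hx
          have h2 := congrArg (fun y => algebraMap k A (c - c')⁻¹ • y) h1
          simpa only [smul_smul, ← map_mul, inv_mul_cancel₀ (sub_ne_zero.2 hne), map_one,
            one_smul, smul_zero] using h2
        have : Small.{v} k := small_of_injective hinj
        exact small_of_finiteType k
      have hT : ∀ t : A ⊗[invAlg k A G] PUnit.{v + 1}, t = 0 := by
        intro t
        induction t with
        | zero => rfl
        | add x y hx hy => rw [hx, hy, add_zero]
        | tmul x y => exact TensorProduct.tmul_zero _ _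
      refine ⟨{ X := fun _ => PUnit, d := fun _ _ _ => 0, d_comp_d := fun _ _ _ _ _ _ => rfl },
        fun _ => inferInstance, ⟨0, fun _ _ _ => rfl⟩, fun _ => 0, ?_, ?_, ?_, ?_⟩
      · intros; simp
      · intros; simp
      · intro j y _
        exact ⟨0, by simp, 0, by rw [hzero j y]; simp⟩
      · intro j t _ _
        exact ⟨0, (hT _).trans (hT _).symm⟩
end

section
/- Let k be a field, A a commutative k-algebra, and G a group acting on A by k-algebra automorphisms. Let E = (⋯ → E^j →^{φ_j} E^{j+1} → ⋯) be a cochain complex of projective A-modules, each term equipped with a G-equivariant structure and all differentials G-equivariant. Fix an integer n, a projective A-module V with a G-equivariant structure, and a G-equivariant A-linear map f : V → E^n such that (i) the image of φ_n ∘ f equals the image of φ_n, and (ii) the induced map Ker(φ_n ∘ f) → H^n(E), v ↦ [f(v)], is surjective. Then there exist a cochain complex E' of projective A-modules with G-equivariant structures and equivariant differentials, and a G-equivariant quasi-isomorphism q : E' → E, such that E'^j = E^j with q_j the identity for all j > n, and E'^n = V with q_n = f. -/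
/-!
STATEMENT 14 (replacement proposition): let `k` be a field, `A` a commutative
`k`-algebra, `G` a group acting on `A` by `k`-algebra automorphisms, and `E`
a `G`-equivariant cochain complex of projective `A`-modules.  Given an
integer `n`, a projective `G`-equivariant `A`-module `V` and a
`G`-equivariant `A`-linear map `f : V → Eⁿ` such that
(i) `im(φₙ ∘ f) = im(φₙ)` and (ii) `Ker(φₙ ∘ f) → Hⁿ(E)`, `v ↦ [f v]`, is
surjective, there are a `G`-equivariant cochain complex `E'` of projective
`A`-modules and a `G`-equivariant quasi-isomorphism `q : E' → E` which in
degrees `j > n` is (up to a `G`-equivariant isomorphism identifying `E'ʲ`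
with `Eʲ`) the identity, and in degree `n` is (up to a `G`-equivariant
isomorphism identifying `E'ⁿ` with `V`) the map `f`.

Quasi-isomorphisms are expressed elementwise (bijectivity on cohomology).
-/

open TensorProduct

universe u v w

/-! ### Auxiliary material for the proof -/

namespace EqvRepl

section LocalUnit

variable {A : Type u} [CommRing A] {Q : Type v} [AddCommGroup Q] [Module A Q]

/-- The trace ideal of a module. -/
def traceIdeal (A : Type u) [CommRing A] (Q : Type v) [AddCommGroup Q] [Module A Q] : Ideal A :=
  Ideal.span {a | ∃ (φ : Q →ₗ[A] A) (y : Q), φ y = a}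

/-- Every element of a projective module is fixed by an element of the trace ideal. -/
theorem exists_trace_smul_eq [Module.Projective A Q] (x : Q) :
    ∃ t ∈ traceIdeal A Q, t • x = x := by
  obtain ⟨s, hs⟩ := (Module.projective_def' (R := A) (P := Q)).1 inferInstance
  have hx : ∀ y : Q, (s y).sum (fun i a => a • i) = y := fun y => by
    have := LinearMap.congr_fun hs y
    simpa [Finsupp.linearCombination_apply] using this
  let N : Submodule A A := Submodule.span A ((fun i => s x i) '' ((s x).support : Set Q))
  have hN : N.FG := Submodule.fg_span ((Finset.finite_toSet _).image _)
  have hmem : ∀ i, s x i ∈ N := fun i => by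
    by_cases hi : s x i = 0
    · rw [hi]; exact N.zero_mem
    · exact Submodule.subset_span ⟨i, by simpa using hi, rfl⟩
  have hle : N ≤ traceIdeal A Q • N := by
    refine Submodule.span_le.2 ?_
    rintro _ ⟨j, -, rfl⟩
    have h1 : s x j = (s x).sum (fun i a => (s i j) • a) := by
      conv_lhs => rw [← hx x]
      rw [map_finsuppSum, Finsupp.sum, Finsupp.finsetSum_apply]
      simp [Finsupp.sum, mul_comm]
    show s x j ∈ traceIdeal A Q • N
    rw [h1]
    refine Submodule.sum_mem _ fun i _ => Submodule.smul_mem_smul ?_ (hmem i)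
    exact Ideal.subset_span ⟨(Finsupp.lapply j).comp s, i, rfl⟩
  obtain ⟨r, hr, hr0⟩ := Submodule.exists_sub_one_mem_and_smul_eq_zero_of_fg_of_le_smul _ N hN hle
  refine ⟨1 - r, by rw [← neg_sub]; exact neg_mem hr, ?_⟩
  have : r • x = 0 := by
    conv_lhs => rw [← hx x]
    rw [Finsupp.sum, Finset.smul_sum]
    refine Finset.sum_eq_zero fun i _ => ?_
    rw [← smul_assoc, hr0 _ (hmem i), zero_smul]
  rw [sub_smul, this, one_smul, sub_zero]

end LocalUnit

/-- A projective equivariant module. -/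
structure EqvMod (A : Type u) (G : Type w) [CommRing A] [Group G] [MulSemiringAction G A] :
    Type (max u w (v + 1)) where
  X : Type v
  [acg : AddCommGroup X]
  [mod : Module A X]
  [act : DistribMulAction G X]
  equivariant : ∀ (g : G) (a : A) (x : X), g • (a • x) = (g • a) • (g • x)
  proj : Module.Projective A X

attribute [instance] EqvMod.acg EqvMod.mod EqvMod.act EqvMod.proj

section Cover

variable {A : Type u} {G : Type w} [CommRing A] [Group G] [MulSemiringAction G A]

/-- Conjugation of an endomorphism. -/
def conj (Q : EqvMod.{u, v, w} A G) (g : G) (h : Q.X →ₗ[A] Q.X) : Q.X →ₗ[A] Q.X where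
  toFun x := g • h (g⁻¹ • x)
  map_add' x y := by simp
  map_smul' a x := by simp [Q.equivariant]

/-- Endomorphisms with image in `K`. -/
def HomInto (Q : EqvMod.{u, v, w} A G) (K : Submodule A Q.X) : Type v :=
  {h : Q.X →ₗ[A] Q.X // ∀ x, h x ∈ K}

/-- The conjugation action. -/
@[reducible] def homIntoAct (Q : EqvMod.{u, v, w} A G) (K : Submodule A Q.X)
    (hK : ∀ (g : G), ∀ x ∈ K, g • x ∈ K) : MulAction G (HomInto Q K) where
  smul g h := ⟨conj Q g h.1, fun x => hK g _ (h.2 _)⟩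
  one_smul h := by
    apply Subtype.ext
    ext x
    show (1 : G) • h.1 ((1 : G)⁻¹ • x) = h.1 x
    simp
  mul_smul g g' h := by
    apply Subtype.ext
    ext x
    show (g * g') • h.1 ((g * g')⁻¹ • x) = g • (g' • h.1 (g'⁻¹ • (g⁻¹ • x)))
    simp [mul_smul]

/-- The action on a direct sum of copies, permuting the summands. -/
noncomputable def finsuppMap {H : Type v} [MulAction G H] {X : Type v} [AddCommGroup X] [DistribMulAction G X]
    (g : G) : (H →₀ X) →+ (H →₀ X) :=
  (Finsupp.mapDomain.addMonoidHom (fun h : H => g • h)).comp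
    (Finsupp.mapRange.addMonoidHom (DistribSMul.toAddMonoidHom X g))

theorem finsuppMap_single {H : Type v} [MulAction G H] {X : Type v} [AddCommGroup X]
    [DistribMulAction G X] (g : G) (h : H) (x : X) :
    finsuppMap g (Finsupp.single h x) = Finsupp.single (g • h) (g • x) := by
  simp [finsuppMap, Finsupp.mapDomain.addMonoidHom, Finsupp.mapDomain_single]

/-- The permuting action on a direct sum of copies. -/
@[reducible] noncomputable def finsuppAct (G : Type w) [Group G] (H : Type v) [MulAction G H] (X : Type v)
    [AddCommGroup X] [DistribMulAction G X] : DistribMulAction G (H →₀ X) where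
  smul g F := finsuppMap g F
  one_smul F := by
    show finsuppMap (1 : G) F = F
    induction F using Finsupp.induction_linear with
    | zero => simp
    | add a b ha hb => rw [map_add, ha, hb]
    | single h x => rw [finsuppMap_single, one_smul, one_smul]
  mul_smul g g' F := by
    show finsuppMap (g * g') F = finsuppMap g (finsuppMap g' F)
    induction F using Finsupp.induction_linear with
    | zero => simp
    | add a b ha hb => simp only [map_add, ha, hb]
    | single h x => simp only [finsuppMap_single, mul_smul]
  smul_zero g := map_zero (finsuppMap g)
  smul_add g := map_add (finsuppMap g)

/-- The direct sum of copies of `Q` indexed by a `G`-set. -/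
noncomputable def finsuppMod (Q : EqvMod.{u, v, w} A G) (H : Type v) [MulAction G H] :
    EqvMod.{u, v, w} A G :=
  @EqvMod.mk A G _ _ _ (H →₀ Q.X) inferInstance inferInstance (finsuppAct G H Q.X)
    (by
      intro g a F
      show finsuppMap g (a • F) = (g • a) • finsuppMap g F
      induction F using Finsupp.induction_linear with
      | zero => simp
      | add a b ha hb => simp only [smul_add, map_add, ha, hb]
      | single h x => simp only [Finsupp.smul_single, finsuppMap_single, Q.equivariant])
    (by
      classical
      exact Module.Projective.of_equiv' (finsuppLequivDFinsupp (ι := H) (M := Q.X) A).symm)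

/-- Every stable submodule of a projective equivariant module is the image of a projective
equivariant module (in the same universe). -/
theorem exists_cover (Q : EqvMod.{u, v, w} A G) (K : Submodule A Q.X)
    (hK : ∀ (g : G), ∀ x ∈ K, g • x ∈ K) :
    ∃ (P : EqvMod.{u, v, w} A G) (p : P.X →ₗ[A] Q.X),
      (∀ (g : G) (x : P.X), p (g • x) = g • p x) ∧ LinearMap.range p = K := by
  let _ := homIntoAct Q K hK
  let p : (HomInto Q K →₀ Q.X) →ₗ[A] Q.X := Finsupp.lsum ℕ (fun h => h.1)
  have hp : ∀ h x, p (Finsupp.single h x) = h.1 x := fun h x => by simp [p]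
  refine ⟨finsuppMod Q (HomInto Q K), p, ?_, ?_⟩
  · intro g F
    show p (finsuppMap g F) = g • p F
    induction F using Finsupp.induction_linear with
    | zero => simp
    | add a b ha hb => simp only [smul_add, map_add, ha, hb]
    | single h x =>
      rw [finsuppMap_single, hp, hp]
      show g • h.1 (g⁻¹ • (g • x)) = _
      simp
  · show LinearMap.range p = K
    apply le_antisymm
    · rintro _ ⟨F, rfl⟩
      induction F using Finsupp.induction_linear with
      | zero => simp
      | add a b ha hb => rw [map_add]; exact K.add_mem ha hb
      | single h x => rw [hp]; exact h.2 x
    · intro x hx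
      obtain ⟨t, ht, htx⟩ := exists_trace_smul_eq (A := A) x
      rw [← htx]
      clear htx
      induction ht using Submodule.span_induction with
      | mem a ha =>
        obtain ⟨φ, y, rfl⟩ := ha
        have hφ : ∀ z, φ.smulRight x z ∈ K := fun z => by
          rw [LinearMap.smulRight_apply]; exact K.smul_mem _ hx
        let h : HomInto Q K := ⟨φ.smulRight x, hφ⟩
        exact ⟨Finsupp.single h y, hp h y⟩
      | zero => rw [zero_smul]; exact Submodule.zero_mem _
      | add a b _ _ ha hb => rw [add_smul]; exact Submodule.add_mem _ ha hb
      | smul a b _ hb => rw [smul_assoc]; exact Submodule.smul_mem _ _ hb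

/-- Product of equivariant modules. -/
def prodMod (P Q : EqvMod.{u, v, w} A G) : EqvMod.{u, v, w} A G where
  X := P.X × Q.X
  equivariant g a x := Prod.ext (P.equivariant g a x.1) (Q.equivariant g a x.2)
  proj := inferInstance

end Cover

section Tower

variable {A : Type u} {G : Type w} [CommRing A] [Group G] [MulSemiringAction G A]

/-- The term of `E` in degree `j`. -/
def term (E : EqvModComplex.{u, w, v} A G) (hproj : ∀ j, Module.Projective A (E.X j)) (j : ℤ) :
    EqvMod.{u, v, w} A G where
  X := E.X j
  equivariant := E.equivariant j
  proj := hproj j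

/-- The part of the construction in degree `n - m`: a module, a map to `E`, and the
submodule of cocycles. -/
structure Stage (E : EqvModComplex.{u, w, v} A G) (n : ℤ) (m : ℕ) where
  P : EqvMod.{u, v, w} A G
  q : ∀ j : ℤ, j = n - m → (P.X →ₗ[A] E.X j)
  Z : Submodule A P.X
  q_eqv : ∀ j h (g : G) x, q j h (g • x) = g • q j h x
  Z_eqv : ∀ (g : G), ∀ x ∈ Z, g • x ∈ Z

/-- What the differential from one stage to the previous one has to satisfy. -/
structure IsNext {E : EqvModComplex.{u, w, v} A G} {n : ℤ} {m : ℕ} (S : Stage E n m)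
    (S' : Stage E n (m + 1)) (d : S'.P.X →ₗ[A] S.P.X) : Prop where
  d_eqv : ∀ (g : G) x, d (g • x) = g • d x
  ker : ∀ x, x ∈ S'.Z ↔ d x = 0
  mem : ∀ x, d x ∈ S.Z
  chain : ∀ i j (hi : i = n - (m + 1 : ℕ)) (hj : j = n - m) (h : i + 1 = j) (x : S'.P.X),
    S.q j hj (d x) = E.d i j h (S'.q i hi x)
  surj : ∀ i j (hi : i = n - (m + 1 : ℕ)) (h : i + 1 = j) (y : E.X i),
    E.d i j h y = 0 → ∃ x ∈ S'.Z, S'.q i hi x = y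
  inj : ∀ i j (hj : j = n - m) (h : i + 1 = j) (x : S.P.X), x ∈ S.Z →
    (∃ b, E.d i j h b = S.q j hj x) → ∃ a, d a = x

theorem exists_next {E : EqvModComplex.{u, w, v} A G}
    (hproj : ∀ j, Module.Projective A (E.X j)) {n : ℤ} {m : ℕ} (S : Stage E n m) :
    ∃ (S' : Stage E n (m + 1)) (d : S'.P.X →ₗ[A] S.P.X), IsNext S S' d := by
  obtain ⟨i, hi⟩ : ∃ i : ℤ, i = n - (m + 1 : ℕ) := ⟨_, rfl⟩
  obtain ⟨j, hj⟩ : ∃ j : ℤ, j = n - m := ⟨_, rfl⟩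
  have hij : i + 1 = j := by rw [hi, hj]; push_cast; ring
  let K : Submodule A (S.P.X × E.X i) :=
    { carrier := {z | z.1 ∈ S.Z ∧ S.q j hj z.1 = E.d i j hij z.2}
      zero_mem' := ⟨S.Z.zero_mem, by simp⟩
      add_mem' := fun {a b} ha hb => ⟨S.Z.add_mem ha.1 hb.1, by
        simp only [Prod.fst_add, Prod.snd_add, map_add, ha.2, hb.2]⟩
      smul_mem' := fun c a ha => ⟨S.Z.smul_mem c ha.1, by
        simp only [Prod.smul_fst, Prod.smul_snd, map_smul, ha.2]⟩ }
  obtain ⟨P, p, hpG, hpK⟩ := exists_cover (prodMod S.P (term E hproj i)) K (by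
    rintro g ⟨x, y⟩ ⟨h1, h2⟩
    exact ⟨S.Z_eqv g _ h1, (S.q_eqv j hj g x).trans
      ((congrArg (fun z => g • z) h2).trans (E.d_equivariant i j hij g y).symm)⟩)
  let d : P.X →ₗ[A] S.P.X := (LinearMap.fst A S.P.X (E.X i)).comp p
  let q : P.X →ₗ[A] E.X i := (LinearMap.snd A S.P.X (E.X i)).comp p
  have hd : ∀ (g : G) x, d (g • x) = g • d x := fun g x => congrArg Prod.fst (hpG g x)
  have hq : ∀ (g : G) x, q (g • x) = g • q x := fun g x => congrArg Prod.snd (hpG g x)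
  have hmem : ∀ x, d x ∈ S.Z ∧ S.q j hj (d x) = E.d i j hij (q x) := fun x => by
    have : p x ∈ K := by rw [← hpK]; exact ⟨x, rfl⟩
    exact this
  have hex : ∀ a b, a ∈ S.Z → S.q j hj a = E.d i j hij b → ∃ x, d x = a ∧ q x = b := by
    intro a b h1 h2
    have : ((a, b) : S.P.X × E.X i) ∈ K := ⟨h1, h2⟩
    rw [← hpK] at this
    obtain ⟨x, hx⟩ := this
    exact ⟨x, congrArg Prod.fst hx, congrArg Prod.snd hx⟩
  clear_value d q
  subst hi
  refine ⟨⟨P, fun j' h => h ▸ q, LinearMap.ker d, ?_, ?_⟩, d, ?_⟩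
  · intro j' h g x
    subst h
    exact hq g x
  · intro g x hx
    rw [LinearMap.mem_ker] at hx ⊢
    rw [hd, hx, smul_zero]
  · constructor
    · exact hd
    · intro x; exact LinearMap.mem_ker
    · exact fun x => (hmem x).1
    · intro i' j' hi' hj' h x
      subst hi'
      obtain rfl : j' = j := by omega
      exact (hmem x).2
    · intro i' j' hi' h y hy
      subst hi'
      obtain rfl : j' = j := by omega
      obtain ⟨x, hx1, hx2⟩ := hex 0 y S.Z.zero_mem (by rw [map_zero, hy])
      exact ⟨x, LinearMap.mem_ker.2 hx1, hx2⟩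
    · rintro i' j' hj' h x hx ⟨b, hb⟩
      obtain rfl : j' = j := by omega
      obtain rfl : i' = n - (m + 1 : ℕ) := by omega
      obtain ⟨a, ha, -⟩ := hex x b hx hb.symm
      exact ⟨a, ha⟩

/-- Position of a degree relative to `n`. -/
inductive Idx (n j : ℤ) : Type
  | hi (h : n < j) : Idx n j
  | lo (m : ℕ) (h : j = n - m) : Idx n j

theorem exists_idx (n j : ℤ) : Nonempty (Idx n j) := by
  by_cases h : n < j
  · exact ⟨.hi h⟩
  · exact ⟨.lo (n - j).toNat (by omega)⟩

variable (E : EqvModComplex.{u, w, v} A G) (hproj : ∀ j, Module.Projective A (E.X j)) {n : ℤ}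
  (S : ∀ m, Stage E n m) (D : ∀ m, (S (m + 1)).P.X →ₗ[A] (S m).P.X)

/-- The terms of the new complex. -/
def obj {j : ℤ} : Idx n j → EqvMod.{u, v, w} A G
  | .hi _ => term E hproj j
  | .lo m _ => (S m).P

/-- The comparison map. -/
def comparison {j : ℤ} : ∀ a : Idx n j, (obj E hproj S a).X →ₗ[A] E.X j
  | .hi _ => (LinearMap.id : E.X j →ₗ[A] E.X j)
  | .lo m h => (S m).q j h

/-- The differential between stages, extended by zero. -/
def stageD (m' m : ℕ) : (S m').P.X →ₗ[A] (S m).P.X :=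
  if h : m' = m + 1 then h ▸ D m else 0

theorem stageD_succ (m : ℕ) : stageD E S D (m + 1) m = D m := by
  simp [stageD]

/-- The differential of the new complex. -/
def diff {i j : ℤ} (h : i + 1 = j) :
    ∀ (a : Idx n i) (b : Idx n j), (obj E hproj S a).X →ₗ[A] (obj E hproj S b).X
  | .hi _, .hi _ => E.d i j h
  | .hi _, .lo _ _ => 0
  | .lo m hm, .hi _ => (E.d i j h).comp ((S m).q i hm)
  | .lo m' _, .lo m _ => stageD E S D m' m

theorem diff_lo_lo {i j : ℤ} (h : i + 1 = j) (m : ℕ) (h1 : i = n - (m + 1 : ℕ))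
    (h2 : j = n - m) (x : (S (m + 1)).P.X) :
    diff E hproj S D h (.lo (m + 1) h1) (.lo m h2) x = D m x := by
  show stageD E S D (m + 1) m x = _
  rw [stageD_succ]

theorem diff_eqv
    (hD : ∀ m, IsNext (S m) (S (m + 1)) (D m)) {i j : ℤ} (h : i + 1 = j) (a : Idx n i) (b : Idx n j) (g : G)
    (x : (obj E hproj S a).X) :
    diff E hproj S D h a b (g • x) = g • diff E hproj S D h a b x := by
  rcases a with ha | ⟨m', ha⟩ <;> rcases b with hb | ⟨m, hb⟩
  · exact E.d_equivariant i j h g x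
  · omega
  · exact (congrArg (E.d i j h) ((S m').q_eqv i ha g x)).trans (E.d_equivariant i j h g _)
  · obtain rfl : m' = m + 1 := by omega
    have e := diff_lo_lo E hproj S D h m ha hb
    exact (e _).trans (((hD m).d_eqv g x).trans (congrArg (fun z => g • z) (e x).symm))

theorem comparison_eqv {j : ℤ} (a : Idx n j) (g : G) (x : (obj E hproj S a).X) :
    comparison E hproj S a (g • x) = g • comparison E hproj S a x := by
  rcases a with ha | ⟨m, ha⟩
  · rfl
  · exact (S m).q_eqv j ha g x

theorem chain
    (hD : ∀ m, IsNext (S m) (S (m + 1)) (D m)) {i j : ℤ} (h : i + 1 = j) (a : Idx n i) (b : Idx n j)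
    (x : (obj E hproj S a).X) :
    comparison E hproj S b (diff E hproj S D h a b x) =
      E.d i j h (comparison E hproj S a x) := by
  rcases a with ha | ⟨m', ha⟩ <;> rcases b with hb | ⟨m, hb⟩
  · rfl
  · omega
  · rfl
  · obtain rfl : m' = m + 1 := by omega
    exact (congrArg ((S m).q j hb) (diff_lo_lo E hproj S D h m ha hb x)).trans
      ((hD m).chain i j ha hb h x)

/-- The submodules `Z` are the cocycles. -/
theorem diff_lo_eq_zero_iff
    (hD : ∀ m, IsNext (S m) (S (m + 1)) (D m))
    (hZ : ∀ i j (hi : i = n - (0 : ℕ)) (h : i + 1 = j) x,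
      x ∈ (S 0).Z ↔ E.d i j h ((S 0).q i hi x) = 0) {i j : ℤ} (h : i + 1 = j) (m : ℕ) (ha : i = n - m) (b : Idx n j)
    (x : (S m).P.X) :
    diff E hproj S D h (.lo m ha) b x = 0 ↔ x ∈ (S m).Z := by
  rcases b with hb | ⟨m', hb⟩
  · obtain rfl : m = 0 := by omega
    exact (hZ i j ha h x).symm
  · obtain rfl : m = m' + 1 := by omega
    rw [diff_lo_lo]
    exact ((hD m').ker x).symm

theorem diff_diff
    (hD : ∀ m, IsNext (S m) (S (m + 1)) (D m))
    (hZ : ∀ i j (hi : i = n - (0 : ℕ)) (h : i + 1 = j) x,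
      x ∈ (S 0).Z ↔ E.d i j h ((S 0).q i hi x) = 0) {i j l : ℤ} (h : i + 1 = j) (h' : j + 1 = l) (a : Idx n i) (b : Idx n j)
    (c : Idx n l) (x : (obj E hproj S a).X) :
    diff E hproj S D h' b c (diff E hproj S D h a b x) = 0 := by
  rcases b with hb | ⟨m, hb⟩
  · rcases c with hc | ⟨m', hc⟩
    · rcases a with ha | ⟨m', ha⟩
      · exact E.d_comp_d _ _ _ _ _ _
      · exact E.d_comp_d _ _ _ _ _ _
    · omega
  · refine (diff_lo_eq_zero_iff E hproj S D hD hZ h' m hb c _).2 ?_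
    rcases a with ha | ⟨m', ha⟩
    · omega
    · obtain rfl : m' = m + 1 := by omega
      have e := diff_lo_lo E hproj S D h m ha hb x
      exact e ▸ (hD m).mem x

end Tower

end EqvRepl

/-- **Replacement of an equivariant complex below a given degree.** -/
theorem equivariant_complex_replacement
    (k : Type*) [Field k]
    (A : Type u) [CommRing A] [Algebra k A]
    (G : Type w) [Group G] [MulSemiringAction G A] [SMulCommClass G k A]
    (E : EqvModComplex.{u, w, v} A G)
    (hproj : ∀ j, Module.Projective A (E.X j))
    (n : ℤ)
    (V : Type v) [AddCommGroup V] [Module A V] [DistribMulAction G V]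
    [Module.Projective A V]
    (hGV : ∀ (g : G) (a : A) (x : V), g • (a • x) = (g • a) • (g • x))
    (f : V →ₗ[A] E.X n)
    (hfG : ∀ (g : G) (x : V), f (g • x) = g • f x)
    -- (i) `im (φₙ ∘ f) = im φₙ`
    (him : LinearMap.range ((E.d n (n+1) rfl).comp f) =
      LinearMap.range (E.d n (n+1) rfl))
    -- (ii) the induced map `Ker (φₙ ∘ f) → Hⁿ(E)`, `v ↦ [f v]`, is surjective
    (hker : ∀ z : E.X n, E.d n (n+1) rfl z = 0 →
      ∃ v : V, E.d n (n+1) rfl (f v) = 0 ∧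
        ∃ b : E.X (n-1), E.d (n-1) n (by omega) b = z - f v) :
    ∃ (E' : EqvModComplex.{u, w, v} A G),
      (∀ j, Module.Projective A (E'.X j)) ∧
      ∃ q : ∀ j, E'.X j →ₗ[A] E.X j,
        -- `q` is a chain map
        (∀ (i j : ℤ) (h : i + 1 = j) (x : E'.X i),
          q j (E'.d i j h x) = E.d i j h (q i x)) ∧
        -- `q` is `G`-equivariant
        (∀ (j : ℤ) (g : G) (x : E'.X j), q j (g • x) = g • q j x) ∧
        -- `q` is a quasi-isomorphism: surjective on cohomology ...
        (∀ (j : ℤ) (y : E.X j), E.d j (j+1) rfl y = 0 →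
          ∃ x : E'.X j, E'.d j (j+1) rfl x = 0 ∧
            ∃ b : E.X (j-1), E.d (j-1) j (by omega) b = y - q j x) ∧
        -- ... and injective on cohomology
        (∀ (j : ℤ) (x : E'.X j), E'.d j (j+1) rfl x = 0 →
          (∃ b : E.X (j-1), E.d (j-1) j (by omega) b = q j x) →
          ∃ a : E'.X (j-1), E'.d (j-1) j (by omega) a = x) ∧
        -- in degrees `j > n`, `E'ʲ = Eʲ` and `qⱼ` is the identity
        (∀ j : ℤ, n < j → ∃ e : E'.X j ≃ₗ[A] E.X j,
          (∀ (g : G) (x : E'.X j), e (g • x) = g • e x) ∧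
          ∀ x : E'.X j, q j x = e x) ∧
        -- in degree `n`, `E'ⁿ = V` and `qₙ = f`
        (∃ e : E'.X n ≃ₗ[A] V,
          (∀ (g : G) (x : E'.X n), e (g • x) = g • e x) ∧
          ∀ x : E'.X n, q n x = f (e x)) := by
  let S0 : EqvRepl.Stage E n 0 :=
    { P := ⟨V, hGV, inferInstance⟩
      q := fun j h => (show n = j by simpa using h.symm) ▸ f
      Z := LinearMap.ker ((E.d n (n+1) rfl).comp f)
      q_eqv := by
        intro j h g x
        obtain rfl : n = j := by simpa using h.symm
        exact hfG g x
      Z_eqv := by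
        intro g x hx
        rw [LinearMap.mem_ker, LinearMap.comp_apply] at hx ⊢
        rw [hfG, E.d_equivariant, hx, smul_zero] }
  have hS0q : ∀ h x, S0.q n h x = f x := fun h x => rfl
  choose next nd hnext using
    fun (m : ℕ) (S : EqvRepl.Stage E n m) => EqvRepl.exists_next hproj S
  let S : ∀ m, EqvRepl.Stage E n m := fun m => Nat.rec S0 (fun m s => next m s) m
  let D : ∀ m, (S (m + 1)).P.X →ₗ[A] (S m).P.X := fun m => nd m (S m)
  have hD : ∀ m, EqvRepl.IsNext (S m) (S (m + 1)) (D m) := fun m => hnext m (S m)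
  have hZ : ∀ i j (hi : i = n - (0 : ℕ)) (h : i + 1 = j) x,
      x ∈ (S 0).Z ↔ E.d i j h ((S 0).q i hi x) = 0 := by
    intro i j hi h x
    obtain rfl : n = i := by simpa using hi.symm
    subst h
    exact LinearMap.mem_ker
  let c : ∀ j, EqvRepl.Idx n j := fun j => (EqvRepl.exists_idx n j).some
  let E' : EqvModComplex.{u, w, v} A G :=
    { X := fun j => (EqvRepl.obj E hproj S (c j)).X
      equivariant := fun j => (EqvRepl.obj E hproj S (c j)).equivariant
      d := fun i j h => EqvRepl.diff E hproj S D h (c i) (c j)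
      d_comp_d := fun i j l h h' x => EqvRepl.diff_diff E hproj S D hD hZ h h' _ _ _ x
      d_equivariant := fun i j h g x => EqvRepl.diff_eqv E hproj S D hD h _ _ g x }
  refine ⟨E', fun j => (EqvRepl.obj E hproj S (c j)).proj,
    fun j => EqvRepl.comparison E hproj S (c j), ?_, ?_, ?_, ?_, ?_, ?_⟩
  · exact fun i j h x => EqvRepl.chain E hproj S D hD h _ _ x
  · exact fun j g x => EqvRepl.comparison_eqv E hproj S _ g x
  · intro j y hy
    show ∃ x : (EqvRepl.obj E hproj S (c j)).X,
      EqvRepl.diff E hproj S D rfl (c j) (c (j+1)) x = 0 ∧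
        ∃ b : E.X (j-1), E.d (j-1) j (by omega) b = y - EqvRepl.comparison E hproj S (c j) x
    generalize c (j+1) = b
    rcases c j with ha | ⟨m, ha⟩
    · rcases b with hb | ⟨m', hb⟩
      · refine ⟨y, hy, 0, ?_⟩
        show _ = y - y
        simp
      · omega
    · rcases m with _ | m
      · obtain rfl : n = j := by simpa using ha.symm
        obtain ⟨v, hv, b', hb'⟩ := hker y hy
        exact ⟨v, (EqvRepl.diff_lo_eq_zero_iff E hproj S D hD hZ _ 0 _ _ _).2
          (LinearMap.mem_ker.2 hv), b', hb'⟩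
      · obtain ⟨x, hx, hxy⟩ := (hD m).surj j (j+1) ha rfl y hy
        refine ⟨x, (EqvRepl.diff_lo_eq_zero_iff E hproj S D hD hZ _ _ _ _ _).2 hx, 0, ?_⟩
        show _ = y - (S (m+1)).q j ha x
        rw [hxy]
        simp
  · intro j
    show ∀ x : (EqvRepl.obj E hproj S (c j)).X,
      EqvRepl.diff E hproj S D rfl (c j) (c (j+1)) x = 0 →
        (∃ b : E.X (j-1), E.d (j-1) j (by omega) b = EqvRepl.comparison E hproj S (c j) x) →
        ∃ a : (EqvRepl.obj E hproj S (c (j-1))).X,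
          EqvRepl.diff E hproj S D (by omega) (c (j-1)) (c j) a = x
    generalize c (j+1) = b
    generalize c (j-1) = a
    rcases c j with ha | ⟨m, ha⟩
    · rintro x hx ⟨b', hb'⟩
      rcases a with ha' | ⟨m, ha'⟩
      · exact ⟨b', hb'⟩
      · obtain rfl : m = 0 := by omega
        obtain rfl : j = n + 1 := by omega
        have key : ∀ (i : ℤ) (hi : i = n - (0 : ℕ)) (h : i + 1 = n + 1) (b' : E.X i),
            ∃ a : V, E.d i (n+1) h (S0.q i hi a) = E.d i (n+1) h b' := by
          intro i hi h b'
          obtain rfl : n = i := by simpa using hi.symm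
          have : E.d n (n+1) rfl b' ∈ LinearMap.range ((E.d n (n+1) rfl).comp f) := by
            rw [him]; exact ⟨b', rfl⟩
          exact this
        obtain ⟨a, ha2⟩ := key _ ha' (by omega) b'
        exact ⟨a, ha2.trans hb'⟩
    · rintro x hx hb
      replace hx := (EqvRepl.diff_lo_eq_zero_iff E hproj S D hD hZ _ m ha b x).1 hx
      rcases a with ha' | ⟨m', ha'⟩
      · omega
      · obtain rfl : m' = m + 1 := by omega
        obtain ⟨a, ha2⟩ := (hD m).inj (j-1) j ha (by omega) x hx hb
        exact ⟨a, (EqvRepl.diff_lo_lo E hproj S D _ m ha' ha a).trans ha2⟩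
  · intro j hj
    show ∃ e : (EqvRepl.obj E hproj S (c j)).X ≃ₗ[A] E.X j,
      (∀ (g : G) x, e (g • x) = g • e x) ∧ ∀ x, EqvRepl.comparison E hproj S (c j) x = e x
    rcases c j with ha | ⟨m, ha⟩
    · exact ⟨LinearEquiv.refl A (E.X j), fun g x => rfl, fun x => rfl⟩
    · omega
  · show ∃ e : (EqvRepl.obj E hproj S (c n)).X ≃ₗ[A] V,
      (∀ (g : G) x, e (g • x) = g • e x) ∧ ∀ x, EqvRepl.comparison E hproj S (c n) x = f (e x)
    rcases c n with ha | ⟨m, ha⟩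
    · omega
    · obtain rfl : m = 0 := by omega
      exact ⟨LinearEquiv.refl A V, fun g x => rfl, fun x => rfl⟩
end
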